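/- Define g : ℕ → ℝ, for n ≥ 4, by g(n) = (9/5)·n·H_n − (1/5)·n·H^alt_n − (89/25)·n + (67/40)·H_n − (3/40)·H^alt_n − 83/800 + (−1)^n/10 − r_n, where r_n = ([n even]/320)·(1/(n−3) + 3/(n−1)) − ([n odd]/320)·(3/(n−2) + 1/n). (g(n) is the exact average number of comparisons of the dual-pivot quicksort algorithm 'Count'.) Then, with A = (9/5)γ + (1/5)·log 2 − 89/25, B = 67/40, C = (67/40)γ + (3/40)·log 2 + 637/800, D = 11/16, E = −67/480, F = −1/8, G = 31/400, the function n ↦ g(n) − ( (9/5)·n·log n + A·n + B·log n + C + D/n + E/n² + (F·[n even] + G)/n³ ) is O(1/n⁴) as n → ∞. -/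

import Mathlib

open Filter Asymptotics Real

/-- The harmonic number `H_n = ∑_{m=1}^n 1/m` (as a real number). -/
noncomputable def Hr (n : ℕ) : ℝ := ∑ m ∈ Finset.Icc 1 n, (1 : ℝ) / m

/-- The alternating harmonic number `H^alt_n = ∑_{m=1}^n (−1)^m/m` (as a real number). -/
noncomputable def Haltr (n : ℕ) : ℝ := ∑ m ∈ Finset.Icc 1 n, (-1 : ℝ) ^ m / m

/-- The remainder term `r_n`. -/
noncomputable def r (n : ℕ) : ℝ :=
  (if Even n then (1 : ℝ) / 320 else 0) * (1 / ((n : ℝ) - 3) + 3 / ((n : ℝ) - 1))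
    - (if Odd n then (1 : ℝ) / 320 else 0) * (3 / ((n : ℝ) - 2) + 1 / (n : ℝ))

/-- The exact average number of comparisons of the dual-pivot quicksort algorithm
"Count". -/
noncomputable def g (n : ℕ) : ℝ :=
  (9 / 5) * (n : ℝ) * Hr n - (1 / 5) * (n : ℝ) * Haltr n - (89 / 25) * (n : ℝ)
    + (67 / 40) * Hr n - (3 / 40) * Haltr n - 83 / 800 + (-1 : ℝ) ^ n / 10 - r n

theorem aux_step (x C : ℝ) (hx : 0 < x) (hx1 : x ≤ 1 / 2) (hC : 0 ≤ C) :
    C * x ^ 6 ≤ C * (x / (1 - x)) ^ 5 - C * x ^ 5 := by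
  have h1 : x + x ^ 2 ≤ x / (1 - x) := by
    rw [le_div_iff₀ (by linarith)]
    nlinarith [pow_pos hx 3]
  have h2 : (x + x ^ 2) ^ 5 ≤ (x / (1 - x)) ^ 5 := by gcongr
  have h3 : x ^ 6 ≤ (x / (1 - x)) ^ 5 - x ^ 5 := by
    have : x ^ 5 + x ^ 6 ≤ (x + x ^ 2) ^ 5 := by
      have e : (x + x ^ 2) ^ 5 - (x ^ 5 + x ^ 6)
          = 4 * x ^ 6 + 10 * x ^ 7 + 10 * x ^ 8 + 5 * x ^ 9 + x ^ 10 := by ring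
      have : 0 ≤ 4 * x ^ 6 + 10 * x ^ 7 + 10 * x ^ 8 + 5 * x ^ 9 + x ^ 10 := by positivity
      linarith
    linarith
  nlinarith

theorem aux_inv (n : ℕ) (hn : 1 ≤ n) : 0 < 1 / ((n : ℝ) + 1) ∧ 1 / ((n : ℝ) + 1) ≤ 1 / 2 ∧
    1 / (n : ℝ) = 1 / ((n : ℝ) + 1) / (1 - 1 / ((n : ℝ) + 1)) := by
  have hn' : (1 : ℝ) ≤ n := by exact_mod_cast hn
  refine ⟨by positivity, ?_, ?_⟩
  · rw [div_le_div_iff₀ (by positivity) (by norm_num)]; linarith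
  · have : 1 - 1 / ((n : ℝ) + 1) = n / (n + 1) := by field_simp; ring
    rw [this]; field_simp

theorem aux_half (u : ℕ → ℝ) (C : ℝ) (hC : 0 ≤ C)
    (ht : Tendsto (fun m : ℕ => u (2 * m)) atTop (nhds 0))
    (hs : ∀ n : ℕ, 1 ≤ n → u (n + 1) - u n ≤ C * (1 / ((n : ℝ) + 1)) ^ 6) (n : ℕ) (hn : 1 ≤ n) :
    - (C * (1 / (n : ℝ)) ^ 5) ≤ u n := by
  have hanti : ∀ k, u (n + k) + C * (1 / ((n + k : ℕ) : ℝ)) ^ 5 ≤ u n + C * (1 / (n : ℝ)) ^ 5 := by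
    intro k
    induction k with
    | zero => simp
    | succ k ih =>
      refine le_trans ?_ ih
      have h1 := hs (n + k) (by omega)
      obtain ⟨a, b, c⟩ := aux_inv (n + k) (by omega)
      have h2 := aux_step _ C a b hC
      rw [← c] at h2
      rw [← add_assoc]
      rw [Nat.cast_succ (n + k)]
      linarith
  have hlim : Tendsto (fun m : ℕ => u (2 * m)) atTop (nhds 0) := ht
  have : (0 : ℝ) ≤ u n + C * (1 / (n : ℝ)) ^ 5 := by
    refine le_of_tendsto hlim ?_
    filter_upwards [eventually_ge_atTop n] with m hm
    have := hanti (2 * m - n)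
    rw [show n + (2 * m - n) = 2 * m by omega] at this
    have h0 : 0 ≤ C * (1 / ((2 * m : ℕ) : ℝ)) ^ 5 := by positivity
    linarith
  linarith

theorem aux_bound (u : ℕ → ℝ) (C : ℝ) (hC : 0 ≤ C)
    (ht : Tendsto (fun m : ℕ => u (2 * m)) atTop (nhds 0))
    (hs : ∀ n : ℕ, 1 ≤ n → |u (n + 1) - u n| ≤ C * (1 / ((n : ℝ) + 1)) ^ 6) (n : ℕ) (hn : 1 ≤ n) :
    |u n| ≤ C * (1 / (n : ℝ)) ^ 5 := by
  rw [abs_le]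
  constructor
  · exact aux_half u C hC ht (fun n hn => (abs_le.1 (hs n hn)).2) n hn
  · have := aux_half (fun n => - u n) C hC (by simpa using ht.neg)
      (fun n hn => by have := (abs_le.1 (hs n hn)).1; linarith) n hn
    linarith

noncomputable def Uu (n : ℕ) : ℝ := Hr n - Real.log n - Real.eulerMascheroniConstant
  - ((1 / (n : ℝ)) / 2 - (1 / (n : ℝ)) ^ 2 / 12 + (1 / (n : ℝ)) ^ 4 / 120)

noncomputable def Ww (n : ℕ) : ℝ := Haltr n + Real.log 2
  - (-1) ^ n * ((1 / (n : ℝ)) / 2 - (1 / (n : ℝ)) ^ 2 / 4 + (1 / (n : ℝ)) ^ 4 / 8)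

theorem Hr_succ (n : ℕ) : Hr (n + 1) = Hr n + 1 / ((n : ℝ) + 1) := by
  unfold Hr
  rw [Finset.sum_Icc_succ_top (by omega)]
  push_cast; rfl

theorem Haltr_succ (n : ℕ) : Haltr (n + 1) = Haltr n + (-1) ^ (n + 1) / ((n : ℝ) + 1) := by
  unfold Haltr
  rw [Finset.sum_Icc_succ_top (by omega)]
  push_cast; rfl

theorem Haltr_two_mul (m : ℕ) : Haltr (2 * m) = Hr m - Hr (2 * m) := by
  induction m with
  | zero => simp [Haltr, Hr]
  | succ m ih =>
    rw [show 2 * (m + 1) = 2 * m + 1 + 1 by ring, Haltr_succ, Haltr_succ, Hr_succ m,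
      Hr_succ (2 * m + 1), Hr_succ (2 * m), ih]
    have e : (-1 : ℝ) ^ (2 * m) = 1 := by rw [pow_mul]; simp
    simp only [pow_succ (-1 : ℝ) (2 * m), pow_succ (-1 : ℝ) (2 * m + 1), e]
    push_cast
    field_simp
    ring

theorem Hr_harmonic (n : ℕ) : Hr n = (harmonic n : ℝ) := by
  rw [harmonic_eq_sum_Icc]
  simp [Hr]

theorem Hr_tendsto : Tendsto (fun n : ℕ => Hr n - Real.log n) atTop
    (nhds Real.eulerMascheroniConstant) := by
  simpa [Hr_harmonic] using Real.tendsto_harmonic_sub_log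

theorem two_tendsto : Tendsto (fun m : ℕ => 2 * m) atTop atTop :=
  tendsto_id.const_mul_atTop' (by norm_num)

theorem poly_tendsto (a b c : ℝ) : Tendsto (fun n : ℕ => (1 / (n : ℝ)) / a - (1 / (n : ℝ)) ^ 2 / b
    + (1 / (n : ℝ)) ^ 4 / c) atTop (nhds 0) := by
  have h : Tendsto (fun n : ℕ => 1 / (n : ℝ)) atTop (nhds 0) :=
    tendsto_one_div_atTop_nhds_zero_nat
  simpa using ((h.div_const a).sub ((h.pow 2).div_const b)).add ((h.pow 4).div_const c)

theorem Uu_tendsto : Tendsto (fun m : ℕ => Uu (2 * m)) atTop (nhds 0) := by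
  have : Tendsto Uu atTop (nhds 0) := by
    have := (Hr_tendsto.sub_const Real.eulerMascheroniConstant).sub (poly_tendsto 2 12 120)
    rw [sub_self, sub_self] at this
    exact this
  exact this.comp two_tendsto

theorem Ww_tendsto : Tendsto (fun m : ℕ => Ww (2 * m)) atTop (nhds 0) := by
  have h1 := (Hr_tendsto.sub (Hr_tendsto.comp two_tendsto)).sub
    ((poly_tendsto 2 4 8).comp two_tendsto)
  rw [sub_self, sub_self] at h1
  refine h1.congr' ?_
  filter_upwards [eventually_ge_atTop 1] with m hm
  have hm' : (m : ℝ) ≠ 0 := by positivity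
  have e : (-1 : ℝ) ^ (2 * m) = 1 := by rw [pow_mul]; simp
  simp only [Function.comp, Ww, Haltr_two_mul, e]
  push_cast
  rw [Real.log_mul (by norm_num) hm']
  ring

theorem div_bound (x P : ℝ) (hx : 0 < x) (hx1 : x ≤ 1 / 2) (hP : |P| ≤ 2) :
    |x ^ 6 * P / (1 - x) ^ 4| ≤ 32 * x ^ 6 := by
  have h1 : (1 / 2 : ℝ) ^ 4 ≤ (1 - x) ^ 4 := by gcongr; linarith
  have h6 : 0 < x ^ 6 := by positivity
  rw [abs_div, abs_mul, abs_of_pos h6, abs_of_pos (lt_of_lt_of_le (by norm_num) h1),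
    div_le_iff₀ (lt_of_lt_of_le (by norm_num) h1)]
  nlinarith

theorem Uu_bound (n : ℕ) (hn : 1 ≤ n) : |Uu n| ≤ 40 * (1 / (n : ℝ)) ^ 5 := by
  refine aux_bound Uu 40 (by norm_num) Uu_tendsto ?_ n hn
  intro n hn
  obtain ⟨a, b, c⟩ := aux_inv n hn
  have hn' : (1 : ℝ) ≤ n := by exact_mod_cast hn
  have hl : Real.log n - Real.log ((n : ℝ) + 1) = Real.log (1 - 1 / ((n : ℝ) + 1)) := by
    rw [← Real.log_div (by positivity) (by positivity)]
    congr 1; field_simp; ring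
  simp only [Uu, Hr_succ, Nat.cast_add, Nat.cast_one]
  rw [c]
  set x := 1 / ((n : ℝ) + 1) with hxd
  have hL := Real.abs_log_sub_add_sum_range_le (x := x) (by rw [abs_of_pos a]; linarith) 5
  rw [abs_of_pos a] at hL
  have hL2 : x ^ 6 / (1 - x) ≤ 2 * x ^ 6 := by
    rw [div_le_iff₀ (by linarith)]
    nlinarith [mul_nonneg (pow_pos a 6).le (sub_nonneg.2 b)]
  simp only [Finset.sum_range_succ, Finset.sum_range_zero] at hL
  norm_num at hL
  have hd := div_bound x (1 / 6 - x / 2 + 13 / 24 * x ^ 2 - x ^ 3 / 5) a b (by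
    have : x ^ 2 ≤ 1 := by nlinarith
    have : x ^ 3 ≤ 1 := by nlinarith
    have : 0 < x ^ 2 := by positivity
    have : 0 < x ^ 3 := by positivity
    rw [abs_le]; constructor <;> linarith)
  have hne : 1 - x ≠ 0 := by linarith
  have key : x ^ 6 * (1 / 6 - x / 2 + 13 / 24 * x ^ 2 - x ^ 3 / 5) / (1 - x) ^ 4
      = x - (x + x ^ 2 / 2 + x ^ 3 / 3 + x ^ 4 / 4 + x ^ 5 / 5)
        + ((x / (1 - x)) / 2 - (x / (1 - x)) ^ 2 / 12 + (x / (1 - x)) ^ 4 / 120)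
        - (x / 2 - x ^ 2 / 12 + x ^ 4 / 120) := by
    field_simp
    ring
  rw [key] at hd
  rw [abs_le] at *
  constructor <;> nlinarith [hL.1, hL.2, hd.1, hd.2, pow_pos a 6]

theorem Ww_bound (n : ℕ) (hn : 1 ≤ n) : |Ww n| ≤ 32 * (1 / (n : ℝ)) ^ 5 := by
  refine aux_bound Ww 32 (by norm_num) Ww_tendsto ?_ n hn
  intro n hn
  obtain ⟨a, b, c⟩ := aux_inv n hn
  simp only [Ww, Haltr_succ, Nat.cast_add, Nat.cast_one]
  rw [c, div_eq_mul_one_div ((-1 : ℝ) ^ (n + 1))]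
  set x := 1 / ((n : ℝ) + 1) with hxd
  have hd := div_bound x (1 / 2 - x / 2 + 1 / 8 * x ^ 2) a b (by
    have : x ^ 2 ≤ 1 := by nlinarith
    have : 0 < x ^ 2 := by positivity
    rw [abs_le]; constructor <;> linarith)
  have hne : 1 - x ≠ 0 := by linarith
  have key : x ^ 6 * (1 / 2 - x / 2 + 1 / 8 * x ^ 2) / (1 - x) ^ 4
      = ((x / (1 - x)) / 2 - (x / (1 - x)) ^ 2 / 4 + (x / (1 - x)) ^ 4 / 8)
        + (x / 2 - x ^ 2 / 4 + x ^ 4 / 8) - x := by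
    field_simp
    ring
  rw [key] at hd
  refine le_trans (le_of_eq ?_) hd
  rw [show ∀ A B : ℝ, |A| = |B| ↔ |A| = |(-1 : ℝ) ^ n * B| by
    intro A B; rw [abs_mul, abs_pow]; simp]
  congr 1
  ring

theorem inv_bound (y c : ℝ) (hy : 4 ≤ y) (hc : 0 ≤ c) (hc3 : c ≤ 3) :
    ∃ d : ℝ, 1 / (y - c) = 1 / y + c / y ^ 2 + c ^ 2 / y ^ 3 + d ∧ |d| ≤ 108 * (1 / y ^ 4) := by
  refine ⟨c ^ 3 / (y ^ 3 * (y - c)), ?_, ?_⟩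
  · have : y - c ≠ 0 := by linarith
    have : y ≠ 0 := by linarith
    field_simp
    ring
  · have h1 : 0 < y - c := by linarith
    have h0 : 0 < y := by linarith
    rw [abs_of_nonneg (by positivity), mul_one_div, div_le_div_iff₀ (by positivity) (by positivity)]
    have : c ^ 3 ≤ 3 ^ 3 := by gcongr
    have h4 : y ≤ 4 * (y - c) := by linarith
    calc c ^ 3 * y ^ 4 = c ^ 3 * (y ^ 3 * y) := by ring
      _ ≤ 3 ^ 3 * (y ^ 3 * (4 * (y - c))) := by gcongr
      _ = _ := by ring

/-- Asymptotics of the average comparison count of "Count":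
`g(n) = (9/5)n log n + An + B log n + C + D/n + E/n² + (F[n even] + G)/n³ + O(1/n⁴)`. -/
theorem count_cost_asymptotics :
    (fun n : ℕ => g n -
        ((9 / 5) * (n : ℝ) * Real.log n
          + ((9 / 5) * Real.eulerMascheroniConstant + (1 / 5) * Real.log 2 - 89 / 25) * (n : ℝ)
          + (67 / 40) * Real.log n
          + ((67 / 40) * Real.eulerMascheroniConstant + (3 / 40) * Real.log 2 + 637 / 800)
          + (11 / 16) / (n : ℝ)
          + (-67 / 480) / (n : ℝ) ^ 2
          + ((-1 / 8) * (if Even n then (1 : ℝ) else 0) + 31 / 400) / (n : ℝ) ^ 3))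
      =O[atTop] (fun n : ℕ => 1 / (n : ℝ) ^ 4) := by
  refine IsBigO.of_bound 1000 ?_
  filter_upwards [eventually_ge_atTop 4] with n hn
  have hy : (4 : ℝ) ≤ n := by exact_mod_cast hn
  have hU := Uu_bound n (by omega)
  have hW := Ww_bound n (by omega)
  have hy0 : (n : ℝ) ≠ 0 := by linarith
  have hHr : Hr n = Uu n + Real.log n + Real.eulerMascheroniConstant
      + ((1 / (n : ℝ)) / 2 - (1 / (n : ℝ)) ^ 2 / 12 + (1 / (n : ℝ)) ^ 4 / 120) := by
    unfold Uu; ring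
  have hHa : Haltr n = Ww n - Real.log 2
      + (-1) ^ n * ((1 / (n : ℝ)) / 2 - (1 / (n : ℝ)) ^ 2 / 4 + (1 / (n : ℝ)) ^ 4 / 8) := by
    unfold Ww; ring
  obtain ⟨d1, e1, b1⟩ := inv_bound n 1 hy (by norm_num) (by norm_num)
  obtain ⟨d2, e2, b2⟩ := inv_bound n 2 hy (by norm_num) (by norm_num)
  obtain ⟨d3, e3, b3⟩ := inv_bound n 3 hy (by norm_num) (by norm_num)
  have hz : 0 < 1 / (n : ℝ) ^ 4 := by positivity
  have hscale : ∀ v C : ℝ, |v| ≤ C * (1 / (n : ℝ)) ^ 5 → |(n : ℝ) * v| ≤ C * (1 / (n : ℝ) ^ 4) := by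
    intro v C hv
    rw [abs_mul, abs_of_pos (by linarith : (0 : ℝ) < n)]
    calc (n : ℝ) * |v| ≤ n * (C * (1 / (n : ℝ)) ^ 5) := by gcongr
      _ = _ := by field_simp
  have hle : (1 / (n : ℝ)) ^ 5 ≤ 1 / (n : ℝ) ^ 4 := by
    rw [one_div_pow]
    apply one_div_le_one_div_of_le (by positivity)
    exact pow_le_pow_right₀ (by linarith) (by norm_num)
  have hU1 := hscale _ _ hU
  have hW1 := hscale _ _ hW
  rw [Real.norm_eq_abs, Real.norm_eq_abs, abs_of_pos hz]
  rw [abs_le] at hU hW hU1 hW1 b1 b2 b3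
  rcases Nat.even_or_odd n with he | ho
  · have hno : ¬ Odd n := Nat.not_odd_iff_even.2 he
    have key : ∀ a b : ℝ, a = b → |b| ≤ 1000 * (1 / (n : ℝ) ^ 4) →
      |a| ≤ 1000 * (1 / (n : ℝ) ^ 4) := by intro a b h; rw [h]; exact id
    refine key _ (9 / 5 * (n * Uu n) + 67 / 40 * Uu n - 1 / 5 * (n * Ww n) - 3 / 40 * Ww n
      + (67 / 4800 - 3 / 320) * (1 / (n : ℝ) ^ 4) - (d3 + 3 * d1) / 320) ?_ ?_
    · have e1' : 3 / ((n : ℝ) - 1) = 3 * (1 / ((n : ℝ) - 1)) := by ring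
      simp only [g, r, if_pos he, if_neg hno, hHr, hHa, he.neg_one_pow, e1', e1, e3]
      field_simp
      ring
    · rw [abs_le]
      constructor <;> linarith [hU.1, hU.2, hW.1, hW.2, hU1.1, hU1.2, hW1.1, hW1.2, b1.1, b1.2,
        b3.1, b3.2]
  · have hno : ¬ Even n := Nat.not_even_iff_odd.2 ho
    have key : ∀ a b : ℝ, a = b → |b| ≤ 1000 * (1 / (n : ℝ) ^ 4) →
      |a| ≤ 1000 * (1 / (n : ℝ) ^ 4) := by intro a b h; rw [h]; exact id
    refine key _ (9 / 5 * (n * Uu n) + 67 / 40 * Uu n - 1 / 5 * (n * Ww n) - 3 / 40 * Ww n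
      + (67 / 4800 + 3 / 320) * (1 / (n : ℝ) ^ 4) + 3 * d2 / 320) ?_ ?_
    · have e2' : 3 / ((n : ℝ) - 2) = 3 * (1 / ((n : ℝ) - 2)) := by ring
      simp only [g, r, if_pos ho, if_neg hno, hHr, hHa, ho.neg_one_pow, e2', e2]
      field_simp
      ring
    · rw [abs_le]
      constructor <;> linarith [hU.1, hU.2, hW.1, hW.2, hU1.1, hU1.2, hW1.1, hW1.2, b2.1, b2.2]
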